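/- arXiv:2402.05143 — 7 statements merged into one kernel-verified Lean document; each statement's English description precedes it below -/
import Mathlib

section
/- Let a, b ∈ ℂ and let P = a·X₁X₂X₃ + b·(X₁³ + X₂³ + X₃³) ∈ ℂ[X₁,X₂,X₃]. Then P factors as a product of three homogeneous linear forms (i.e., P = L₁·L₂·L₃ with each Lᵢ homogeneous of degree 1) if and only if there exists λ ∈ ℂ with H(P) = λ·P. -/
open MvPolynomial

/-- The Hessian determinant of a polynomial in three variables. -/
noncomputable def hessianDet (P : MvPolynomial (Fin 3) ℂ) : MvPolynomial (Fin 3) ℂ :=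
  Matrix.det (Matrix.of fun i j : Fin 3 => pderiv i (pderiv j P))

theorem pderiv_lin_aux (L : MvPolynomial (Fin 3) ℂ) (h : L.IsHomogeneous 1) :
    ∃ l : Fin 3 → ℂ, ∀ i, pderiv i L = MvPolynomial.C (l i) := by
  refine ⟨fun i => coeff 0 (pderiv i L), fun i => ?_⟩
  have h1 : (pderiv i L).IsHomogeneous 0 := h.pderiv
  exact totalDegree_eq_zero_iff_eq_C.1 (Nat.le_zero.1 h1.totalDegree_le)

theorem hess_prod_aux (L M N : MvPolynomial (Fin 3) ℂ) (l m n : Fin 3 → ℂ)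
    (hl : ∀ i, pderiv i L = MvPolynomial.C (l i))
    (hm : ∀ i, pderiv i M = MvPolynomial.C (m i))
    (hn : ∀ i, pderiv i N = MvPolynomial.C (n i)) :
    hessianDet (L * M * N) =
      MvPolynomial.C (2 * (Matrix.det !![l 0, l 1, l 2; m 0, m 1, m 2; n 0, n 1, n 2]) ^ 2)
        * (L * M * N) := by
  have key : ∀ i j, pderiv i (pderiv j (L * M * N)) =
      C (l j) * C (m i) * N + C (l j) * C (n i) * M + C (m j) * C (l i) * N
      + C (m j) * C (n i) * L + C (n j) * C (l i) * M + C (n j) * C (m i) * L := by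
    intro i j
    simp only [Derivation.leibniz, map_add, smul_eq_mul, hl, hm, hn, pderiv_C]
    ring
  simp only [hessianDet, Matrix.det_fin_three, Matrix.of_apply, key]
  simp
  rw [show (C 2 : MvPolynomial (Fin 3) ℂ) = 2 from map_ofNat C 2]
  ring

theorem hess_P_aux (a b : ℂ) :
    hessianDet (MvPolynomial.C a * (X 0 * X 1 * X 2) +
        MvPolynomial.C b * (X 0 ^ 3 + X 1 ^ 3 + X 2 ^ 3)) =
      C (216 * b ^ 3 + 2 * a ^ 3) * (X 0 * X 1 * X 2)
        + C (-6 * a ^ 2 * b) * (X 0 ^ 3 + X 1 ^ 3 + X 2 ^ 3) := by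
  simp only [hessianDet, Matrix.det_fin_three, Matrix.of_apply]
  have h3 : ∀ i : Fin 3, pderiv i (3 : MvPolynomial (Fin 3) ℂ) = 0 := fun i => by
    rw [show (3 : MvPolynomial (Fin 3) ℂ) = C 3 from (map_ofNat C 3).symm, pderiv_C]
  simp [pderiv_X, Pi.single_apply, Derivation.leibniz, Derivation.leibniz_pow, h3]
  simp only [show (C 216 : MvPolynomial (Fin 3) ℂ) = 216 from map_ofNat C 216,
    show (C 6 : MvPolynomial (Fin 3) ℂ) = 6 from map_ofNat C 6,
    show (C 2 : MvPolynomial (Fin 3) ℂ) = 2 from map_ofNat C 2]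
  ring

theorem lin_hom_aux (p q r : ℂ) :
    (C p * X 0 + C q * X 1 + C r * X 2 : MvPolynomial (Fin 3) ℂ).IsHomogeneous 1 :=
  ((isHomogeneous_C_mul_X p 0).add (isHomogeneous_C_mul_X q 1)).add (isHomogeneous_C_mul_X r 2)

theorem omega_aux : ∃ w : ℂ, w ^ 2 + w + 1 = 0 := by
  obtain ⟨s, hs⟩ := IsAlgClosed.exists_pow_nat_eq (-3 : ℂ) (n := 2) (by norm_num)
  exact ⟨(-1 + s) / 2, by linear_combination hs / 4⟩

theorem hessian_criterion_linear_factors (a b : ℂ) (P : MvPolynomial (Fin 3) ℂ)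
    (hP : P = MvPolynomial.C a * (X 0 * X 1 * X 2) +
        MvPolynomial.C b * (X 0 ^ 3 + X 1 ^ 3 + X 2 ^ 3)) :
    (∃ L₁ L₂ L₃ : MvPolynomial (Fin 3) ℂ,
        L₁.IsHomogeneous 1 ∧ L₂.IsHomogeneous 1 ∧ L₃.IsHomogeneous 1 ∧ P = L₁ * L₂ * L₃) ↔
      ∃ lam : ℂ, hessianDet P = MvPolynomial.C lam * P := by
  constructor
  · rintro ⟨L, M, N, hL, hM, hN, rfl⟩
    obtain ⟨l, hl⟩ := pderiv_lin_aux L hL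
    obtain ⟨m, hm⟩ := pderiv_lin_aux M hM
    obtain ⟨n, hn⟩ := pderiv_lin_aux N hN
    exact ⟨_, hess_prod_aux L M N l m n hl hm hn⟩
  · rintro ⟨lam, h⟩
    rw [hP, hess_P_aux] at h
    by_cases hb : b = 0
    · refine ⟨C a * X 0, X 1, X 2, isHomogeneous_C_mul_X a 0, isHomogeneous_X _ _,
        isHomogeneous_X _ _, ?_⟩
      rw [hP, hb, C_0]
      ring
    · have e1 := congrArg (eval ![1, 0, 0]) h
      have e2 := congrArg (eval ![1, 1, 1]) h
      simp at e1 e2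
      have hlam : lam = -6 * a ^ 2 := by
        apply mul_right_cancel₀ hb
        linear_combination -e1
      subst hlam
      have ha : a ^ 3 = -27 * b ^ 3 := by linear_combination e2 / 8
      obtain ⟨w, hw⟩ := omega_aux
      -- c = -a/(3b), so a = -3 b c and c^3 = 1
      obtain ⟨c, hc⟩ : ∃ c : ℂ, a = -3 * b * c := ⟨-a / (3 * b), by field_simp⟩
      have hc3 : c ^ 3 = 1 := by
        have hb3 : b ^ 3 ≠ 0 := pow_ne_zero 3 hb
        apply mul_left_cancel₀ hb3
        rw [hc] at ha
        linear_combination -ha / 27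
      refine ⟨C b * X 0 + C b * X 1 + C (b * c) * X 2, C 1 * X 0 + C w * X 1 + C (w ^ 2 * c) * X 2,
        C 1 * X 0 + C (w ^ 2) * X 1 + C (w * c) * X 2, lin_hom_aux _ _ _, lin_hom_aux _ _ _,
        lin_hom_aux _ _ _, ?_⟩
      rw [hP, hc]
      apply MvPolynomial.funext
      intro x
      simp
      generalize x 0 = X, x 1 = Y, x 2 = Z
      have hw3 : w ^ 3 = 1 := by linear_combination (w - 1) * hw
      have hw2 : w ^ 2 = - w - 1 := by linear_combination hw
      rw [hw2]
      have hww : w * w = - w - 1 := by linear_combination hw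
      grind
end

section
/- Let a, b ∈ ℂ, P₃ = X₁X₂X₃ and S₃ = X₁³ + X₂³ + X₃³ in ℂ[X₁,X₂,X₃]. Then H(a·P₃ + b·S₃) = (2a³ + 216b³)·P₃ − 6a²b·S₃. -/
open MvPolynomial

theorem hessian_of_aP3_plus_bS3 (a b : ℂ) :
    hessianDet (MvPolynomial.C a * (X 0 * X 1 * X 2) +
        MvPolynomial.C b * (X 0 ^ 3 + X 1 ^ 3 + X 2 ^ 3)) =
      MvPolynomial.C (2 * a ^ 3 + 216 * b ^ 3) * (X 0 * X 1 * X 2) -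
        MvPolynomial.C (6 * a ^ 2 * b) * (X 0 ^ 3 + X 1 ^ 3 + X 2 ^ 3) := by
  have h2 : (C (2:ℂ) : MvPolynomial (Fin 3) ℂ) = 2 := map_ofNat C 2
  have h6 : (C (6:ℂ) : MvPolynomial (Fin 3) ℂ) = 6 := map_ofNat C 6
  have h216 : (C (216:ℂ) : MvPolynomial (Fin 3) ℂ) = 216 := map_ofNat C 216
  have hn : ∀ i : Fin 3, pderiv i (3 : MvPolynomial (Fin 3) ℂ) = 0 := fun i => by
    rw [← map_ofNat (C : ℂ →+* MvPolynomial (Fin 3) ℂ) 3, pderiv_C]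
  simp [hessianDet, Matrix.det_fin_three, Derivation.leibniz, Derivation.leibniz_pow,
    pderiv_X, Pi.single_apply, h2, h6, h216, hn]
  ring
end

section
/- Let a, b ∈ ℂ, P₃ = X₁X₂X₃ and S₃ = X₁³ + X₂³ + X₃³ in ℂ[X₁,X₂,X₃]. Then a·P₃ + b·S₃ factors as a product of three homogeneous linear forms if and only if b = 0 or a³ = −27·b³. -/
open MvPolynomial

lemma lin_form (L : MvPolynomial (Fin 3) ℂ) (h : L.IsHomogeneous 1) :
    ∃ α β γ : ℂ, L = C α * X 0 + C β * X 1 + C γ * X 2 := by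
  have h1 : L ∈ homogeneousSubmodule (Fin 3) ℂ 1 := h
  rw [homogeneousSubmodule_one_eq_span_X, Submodule.mem_span_range_iff_exists_fun] at h1
  obtain ⟨c, hc⟩ := h1
  refine ⟨c 0, c 1, c 2, ?_⟩
  rw [← hc, Fin.sum_univ_three]
  simp only [smul_eq_C_mul]

lemma cube_ident {R : Type*} [CommRing R] (x y z A B M W : R) (hA : A = -3 * B * M)
    (hM : M ^ 3 = 1) (h : 1 + W + W ^ 2 = 0) :
    A * (x * y * z) + B * (x ^ 3 + y ^ 3 + z ^ 3) =
      (B * x + B * y + (B * M) * z) * (1 * x + W * y + (W ^ 2 * M) * z) *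
        (1 * x + W ^ 2 * y + (W * M) * z) := by
  have h3 : W ^ 3 - 1 = 0 := by linear_combination (W - 1) * h
  have e : (1 * x + W * y + (W ^ 2 * M) * z) * (1 * x + W ^ 2 * y + (W * M) * z) =
      x ^ 2 + y ^ 2 + (M * z) ^ 2 - x * y - y * (M * z) - x * (M * z) := by
    linear_combination (x * y + x * (M * z) + y * (M * z)) * h +
      (y ^ 2 + (M * z) ^ 2 + W * y * (M * z)) * h3
  rw [mul_assoc (B * x + B * y + (B * M) * z), e, hA]
  linear_combination (-B * z ^ 3) * hM

lemma hom_form (α β γ : ℂ) :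
    (C α * X 0 + C β * X 1 + C γ * X 2 : MvPolynomial (Fin 3) ℂ).IsHomogeneous 1 :=
  ((isHomogeneous_C_mul_X _ _).add (isHomogeneous_C_mul_X _ _)).add (isHomogeneous_C_mul_X _ _)

theorem aP3_plus_bS3_factors_iff (a b : ℂ) :
    (∃ L₁ L₂ L₃ : MvPolynomial (Fin 3) ℂ,
        L₁.IsHomogeneous 1 ∧ L₂.IsHomogeneous 1 ∧ L₃.IsHomogeneous 1 ∧
        MvPolynomial.C a * (X 0 * X 1 * X 2) +
            MvPolynomial.C b * (X 0 ^ 3 + X 1 ^ 3 + X 2 ^ 3) = L₁ * L₂ * L₃) ↔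
      b = 0 ∨ a ^ 3 = -27 * b ^ 3 := by
  constructor
  · rintro ⟨L₁, L₂, L₃, h1, h2, h3, h⟩
    by_cases hb : b = 0
    · exact Or.inl hb
    right
    obtain ⟨α, β, γ, rfl⟩ := lin_form L₁ h1
    have key : ∀ x y z : ℂ, α * x + β * y + γ * z = 0 →
        a * (x * y * z) + b * (x ^ 3 + y ^ 3 + z ^ 3) = 0 := by
      intro x y z hl
      have := congrArg (eval ![x, y, z]) h
      simpa [hl] using this
    have hα : α ≠ 0 := by
      rintro rfl
      have := key 1 0 0 (by ring)
      simp [hb] at this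
    have hβ : β ≠ 0 := by
      rintro rfl
      have := key 0 1 0 (by ring)
      simp [hb] at this
    obtain ⟨p, hp⟩ : ∃ p, α * p = -β := ⟨-β / α, by field_simp⟩
    obtain ⟨q, hq⟩ : ∃ q, α * q = -γ := ⟨-γ / α, by field_simp⟩
    have k : ∀ y z : ℂ, a * ((p * y + q * z) * y * z) +
        b * ((p * y + q * z) ^ 3 + y ^ 3 + z ^ 3) = 0 := fun y z =>
      key _ y z (by linear_combination y * hp + z * hq)
    have hp3 : p ^ 3 = -1 := by
      apply mul_left_cancel₀ hb
      linear_combination k 1 0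
    have hq3 : q ^ 3 = -1 := by
      apply mul_left_cancel₀ hb
      linear_combination k 0 1
    have hp0 : p ≠ 0 := by
      rintro rfl
      norm_num at hp3
    have e : p * (a + 3 * b * p * q) = 0 := by
      linear_combination (1 / 2 : ℂ) * k 1 1 - (1 / 2 : ℂ) * k 1 (-1) - b * hq3
    have e' : a = -3 * b * p * q := by
      rcases mul_eq_zero.1 e with h0 | h0
      · exact absurd h0 hp0
      · linear_combination h0
    rw [e']
    linear_combination (-27 * b ^ 3 * q ^ 3) * hp3 + 27 * b ^ 3 * hq3
  · intro h
    by_cases hb : b = 0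
    · subst hb
      refine ⟨C a * X 0, X 1, X 2, isHomogeneous_C_mul_X _ _, isHomogeneous_X _ _,
        isHomogeneous_X _ _, ?_⟩
      simp only [map_zero]
      ring
    · have h := h.resolve_left hb
      obtain ⟨m, hm⟩ : ∃ m, a = -3 * b * m := ⟨-a / (3 * b), by field_simp⟩
      have hm3 : m ^ 3 = 1 := by
        apply mul_left_cancel₀ (pow_ne_zero 3 hb)
        rw [hm] at h
        linear_combination (-1 / 27 : ℂ) * h
      obtain ⟨w, hw⟩ : ∃ w : ℂ, 1 + w + w ^ 2 = 0 := by
        obtain ⟨w, hr⟩ : ∃ w : ℂ, IsPrimitiveRoot w 3 :=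
          ⟨_, Complex.isPrimitiveRoot_exp 3 (by norm_num)⟩
        have := hr.geom_sum_eq_zero (by norm_num)
        exact ⟨w, by simpa [Finset.sum_range_succ] using this⟩
      refine ⟨C b * X 0 + C b * X 1 + C (b * m) * X 2, C 1 * X 0 + C w * X 1 + C (w ^ 2 * m) * X 2,
        C 1 * X 0 + C (w ^ 2) * X 1 + C (w * m) * X 2, hom_form _ _ _, hom_form _ _ _,
        hom_form _ _ _, ?_⟩
      simp only [C_mul, C_pow, C_1]
      apply cube_ident
      · rw [hm, C_mul, C_mul, C_neg, show (C 3 : MvPolynomial (Fin 3) ℂ) = 3 from map_ofNat C 3]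
      · rw [← C_pow, hm3, C_1]
      · rw [← C_pow, ← C_1, ← C_add, ← C_add, hw, C_0]
end

section
/- Let L₁, L₂, L₃ ∈ ℂ[X₁,X₂,X₃] be homogeneous linear forms, Lᵢ = Σⱼ Mᵢⱼ·Xⱼ, and let M be the 3×3 matrix of their coefficients (Mᵢⱼ). Then H(L₁·L₂·L₃) = 2·det(M)²·L₁·L₂·L₃. -/
open MvPolynomial

theorem hessian_of_product_of_linear_forms (M : Matrix (Fin 3) (Fin 3) ℂ)
    (L : Fin 3 → MvPolynomial (Fin 3) ℂ)
    (hL : ∀ i, L i = ∑ j, MvPolynomial.C (M i j) * X j) :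
    hessianDet (L 0 * L 1 * L 2) =
      MvPolynomial.C (2 * M.det ^ 2) * (L 0 * L 1 * L 2) := by
  have hd : ∀ i k, pderiv i (L k) = C (M k i) := by
    intro i k
    rw [hL k, Fin.sum_univ_three]
    fin_cases i <;> simp [pderiv_X, Pi.single_apply]
  clear hL
  have hdd : ∀ i j, pderiv i (pderiv j (L 0 * L 1 * L 2)) =
      (C (M 0 i) * C (M 1 j) + C (M 1 i) * C (M 0 j)) * L 2
      + (C (M 0 i) * C (M 2 j) + C (M 2 i) * C (M 0 j)) * L 1
      + (C (M 1 i) * C (M 2 j) + C (M 2 i) * C (M 1 j)) * L 0 := by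
    intro i j
    simp only [pderiv_mul, hd, map_add, pderiv_C]
    ring
  unfold hessianDet
  rw [Matrix.det_fin_three, Matrix.det_fin_three]
  simp only [Matrix.of_apply, hdd, map_mul, map_pow, map_add, map_sub, map_ofNat]
  ring
end

section
/- In ℂ[X₁,X₂,X₃], let P₃ = X₁X₂X₃, S₃ = X₁³ + X₂³ + X₃³, F₃ = −3(1+√3)·P₃ + S₃ and Φ₃ = −3(1−√3)·P₃ + S₃. Then H(F₃) = −108(2+√3)·Φ₃ and H(Φ₃) = −108(2−√3)·F₃. -/
open MvPolynomial

theorem hess_aux (a : ℂ) :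
    hessianDet (MvPolynomial.C a * (X 0 * X 1 * X 2) + (X 0 ^ 3 + X 1 ^ 3 + X 2 ^ 3)) =
      MvPolynomial.C (216 + 2 * a ^ 3) * (X 0 * X 1 * X 2)
        - MvPolynomial.C (6 * a ^ 2) * (X 0 ^ 3 + X 1 ^ 3 + X 2 ^ 3) := by
  have e : ∀ (n : ℕ) [n.AtLeastTwo],
      (MvPolynomial.C (OfNat.ofNat n : ℂ) : MvPolynomial (Fin 3) ℂ) = OfNat.ofNat n :=
    fun n _ => map_ofNat _ n
  have d : ∀ (i : Fin 3) (n : ℕ) [n.AtLeastTwo],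
      pderiv i (OfNat.ofNat n : MvPolynomial (Fin 3) ℂ) = 0 := by
    intro i n _
    rw [← e n]; exact pderiv_C
  unfold hessianDet
  rw [Matrix.det_fin_three]
  simp [pderiv_X, Pi.single_apply, Derivation.leibniz, Derivation.leibniz_pow, d, e]
  ring

theorem hessians_of_F3_and_Phi3 (s : ℂ) (hs : s = ((Real.sqrt 3 : ℝ) : ℂ))
    (P₃ S₃ F₃ Φ₃ : MvPolynomial (Fin 3) ℂ)
    (hP₃ : P₃ = X 0 * X 1 * X 2)
    (hS₃ : S₃ = X 0 ^ 3 + X 1 ^ 3 + X 2 ^ 3)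
    (hF₃ : F₃ = MvPolynomial.C (-3 * (1 + s)) * P₃ + S₃)
    (hΦ₃ : Φ₃ = MvPolynomial.C (-3 * (1 - s)) * P₃ + S₃) :
    hessianDet F₃ = MvPolynomial.C (-108 * (2 + s)) * Φ₃ ∧
      hessianDet Φ₃ = MvPolynomial.C (-108 * (2 - s)) * F₃ := by
  have h2 : s ^ 2 = 3 := by
    rw [hs, ← Complex.ofReal_pow, Real.sq_sqrt (by norm_num)]; norm_num
  subst hF₃ hΦ₃ hP₃ hS₃
  rw [hess_aux, hess_aux]
  have key : ∀ a b c : ℂ, 216 + 2 * a ^ 3 = c * b → -(6 * a ^ 2) = c →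
      (MvPolynomial.C (216 + 2 * a ^ 3) * (X 0 * X 1 * X 2)
        - MvPolynomial.C (6 * a ^ 2) * (X 0 ^ 3 + X 1 ^ 3 + X 2 ^ 3) : MvPolynomial (Fin 3) ℂ)
      = MvPolynomial.C c * (MvPolynomial.C b * (X 0 * X 1 * X 2)
        + (X 0 ^ 3 + X 1 ^ 3 + X 2 ^ 3)) := by
    intro a b c h1 h3
    rw [h1, ← h3, MvPolynomial.C_mul, MvPolynomial.C_neg]
    ring
  constructor
  · apply key
    · linear_combination (162 - 54 * s) * h2
    · linear_combination (-54) * h2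
  · apply key
    · linear_combination (162 + 54 * s) * h2
    · linear_combination (-54) * h2
end

section
/- In ℂ[X₁,X₂,X₃], let P₃ = X₁X₂X₃, S₃ = X₁³ + X₂³ + X₃³, F₃ = −3(1+√3)·P₃ + S₃, Φ₃ = −3(1−√3)·P₃ + S₃, F₆ = (HB(F₃,Φ₃) + HB(Φ₃,F₃))/648, Φ₁₂ = −H(F₆)/108000, and R₉ = (X₁³−X₂³)(X₁³−X₃³)(X₂³−X₃³). Then Φ₁₂ divides HB(F₆,R₉) in ℂ[X₁,X₂,X₃]; more precisely, there exists a homogeneous polynomial F₁₂ ∈ ℂ[X₁,X₂,X₃] of degree 12 with HB(F₆,R₉) = 675·Φ₁₂·F₁₂. -/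
open MvPolynomial

/-- The bordered Hessian of two polynomials in three variables: the determinant of the
4×4 matrix whose upper-left 3×3 block is the Hessian matrix of `P₂`, bordered by the
gradient of `P₁` in the last row and column, with `0` in the corner. -/
noncomputable def borderedHessian (P₁ P₂ : MvPolynomial (Fin 3) ℂ) : MvPolynomial (Fin 3) ℂ :=
  Matrix.det (Matrix.of fun i j : Fin 4 =>
    if hi : (i : ℕ) < 3 then
      if hj : (j : ℕ) < 3 then pderiv (⟨i, hi⟩ : Fin 3) (pderiv (⟨j, hj⟩ : Fin 3) P₂)
      else pderiv (⟨i, hi⟩ : Fin 3) P₁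
    else
      if hj : (j : ℕ) < 3 then pderiv (⟨j, hj⟩ : Fin 3) P₁
      else 0)

/-- The Jacobian determinant of three polynomials in three variables:
`det((∂Pⱼ/∂Xᵢ)_{i,j})`. -/
noncomputable def jacobianDet (P₁ P₂ P₃ : MvPolynomial (Fin 3) ℂ) : MvPolynomial (Fin 3) ℂ :=
  Matrix.det (Matrix.of fun i j : Fin 3 => pderiv i (![P₁, P₂, P₃] j))


theorem aux_bh (P Q a b c u v w u0 u1 u2 v0 v1 v2 w0 w1 w2 : MvPolynomial (Fin 3) ℂ)
    (ha : pderiv 0 P = a) (hb : pderiv 1 P = b) (hc : pderiv 2 P = c)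
    (hu : pderiv 0 Q = u) (hv : pderiv 1 Q = v) (hw : pderiv 2 Q = w)
    (hu0 : pderiv 0 u = u0) (hu1 : pderiv 1 u = u1) (hu2 : pderiv 2 u = u2)
    (hv0 : pderiv 0 v = v0) (hv1 : pderiv 1 v = v1) (hv2 : pderiv 2 v = v2)
    (hw0 : pderiv 0 w = w0) (hw1 : pderiv 1 w = w1) (hw2 : pderiv 2 w = w2) :
    borderedHessian P Q =
      -(a * (a * (v1 * w2 - w1 * v2) - b * (u1 * w2 - w1 * u2) + c * (u1 * v2 - v1 * u2)))
      + b * (a * (v0 * w2 - w0 * v2) - b * (u0 * w2 - w0 * u2) + c * (u0 * v2 - v0 * u2))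
      - c * (a * (v0 * w1 - w0 * v1) - b * (u0 * w1 - w0 * u1) + c * (u0 * v1 - v0 * u1)) := by
  have e0 : (⟨0, by decide⟩ : Fin 3) = 0 := rfl
  have e1 : (⟨1, by decide⟩ : Fin 3) = 1 := rfl
  have e2 : (⟨2, by decide⟩ : Fin 3) = 2 := rfl
  have hM : (Matrix.of fun i j : Fin 4 =>
    if hi : (i : ℕ) < 3 then
      if hj : (j : ℕ) < 3 then pderiv (⟨i, hi⟩ : Fin 3) (pderiv (⟨j, hj⟩ : Fin 3) Q)
      else pderiv (⟨i, hi⟩ : Fin 3) P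
    else
      if hj : (j : ℕ) < 3 then pderiv (⟨j, hj⟩ : Fin 3) P
      else 0) = !![u0, v0, w0, a; u1, v1, w1, b; u2, v2, w2, c; a, b, c, 0] := by
    subst hu0 hu1 hu2 hv0 hv1 hv2 hw0 hw1 hw2
    subst ha hb hc hu hv hw
    ext1 i j
    fin_cases i <;> fin_cases j <;> rfl
  unfold borderedHessian
  rw [hM, Matrix.det_succ_row_zero]
  simp [Fin.sum_univ_succ, Matrix.det_fin_three, Fin.succAbove]
  ring

theorem aux_hd (Q u v w u0 u1 u2 v0 v1 v2 w0 w1 w2 : MvPolynomial (Fin 3) ℂ)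
    (hu : pderiv 0 Q = u) (hv : pderiv 1 Q = v) (hw : pderiv 2 Q = w)
    (hu0 : pderiv 0 u = u0) (hu1 : pderiv 1 u = u1) (hu2 : pderiv 2 u = u2)
    (hv0 : pderiv 0 v = v0) (hv1 : pderiv 1 v = v1) (hv2 : pderiv 2 v = v2)
    (hw0 : pderiv 0 w = w0) (hw1 : pderiv 1 w = w1) (hw2 : pderiv 2 w = w2) :
    hessianDet Q =
      u0 * (v1 * w2 - w1 * v2) - v0 * (u1 * w2 - w1 * u2) + w0 * (u1 * v2 - v1 * u2) := by
  subst hu0 hu1 hu2 hv0 hv1 hv2 hw0 hw1 hw2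
  subst hu hv hw
  unfold hessianDet
  rw [Matrix.det_fin_three]
  simp only [Matrix.of_apply]
  ring

theorem aux_num2 (i : Fin 3) : pderiv i (2 : MvPolynomial (Fin 3) ℂ) = 0 :=
  (pderiv i).map_natCast 2

theorem aux_num3 (i : Fin 3) : pderiv i (3 : MvPolynomial (Fin 3) ℂ) = 0 :=
  (pderiv i).map_natCast 3

theorem aux_num6 (i : Fin 3) : pderiv i (6 : MvPolynomial (Fin 3) ℂ) = 0 :=
  (pderiv i).map_natCast 6

theorem aux_num10 (i : Fin 3) : pderiv i (10 : MvPolynomial (Fin 3) ℂ) = 0 :=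
  (pderiv i).map_natCast 10

theorem aux_num30 (i : Fin 3) : pderiv i (30 : MvPolynomial (Fin 3) ℂ) = 0 :=
  (pderiv i).map_natCast 30

/-- derivatives of the cubic pencil -/
theorem aux_cubic (m : ℂ) (i : Fin 3) :
    pderiv i (C m * (X 0 * X 1 * X 2) + (X 0 ^ 3 + X 1 ^ 3 + X 2 ^ 3)) =
      ![C m * (X 1 * X 2) + 3 * X 0 ^ 2, C m * (X 0 * X 2) + 3 * X 1 ^ 2,
        C m * (X 0 * X 1) + 3 * X 2 ^ 2] i := by
  fin_cases i <;>
    simp [-mul_eq_mul_left_iff, pderiv_X, Derivation.leibniz_pow, aux_num2, aux_num3,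
      aux_num6, aux_num10, aux_num30] <;> ring

theorem aux_bh_cubic (m n : ℂ) :
    borderedHessian (C m * (X 0 * X 1 * X 2) + (X 0 ^ 3 + X 1 ^ 3 + X 2 ^ 3))
      (C n * (X 0 * X 1 * X 2) + (X 0 ^ 3 + X 1 ^ 3 + X 2 ^ 3)) =
      (fun a b c u0 v0 w0 v1 w1 w2 : MvPolynomial (Fin 3) ℂ =>
       -(a * (a * (v1 * w2 - w1 * w1) - b * (v0 * w2 - w1 * w0) + c * (v0 * w1 - v1 * w0)))
      + b * (a * (v0 * w2 - w0 * w1) - b * (u0 * w2 - w0 * w0) + c * (u0 * w1 - v0 * w0))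
      - c * (a * (v0 * w1 - w0 * v1) - b * (u0 * w1 - w0 * v0) + c * (u0 * v1 - v0 * v0)))
      (C m * (X 1 * X 2) + 3 * X 0 ^ 2) (C m * (X 0 * X 2) + 3 * X 1 ^ 2)
        (C m * (X 0 * X 1) + 3 * X 2 ^ 2)
      (6 * X 0) (C n * X 2) (C n * X 1) (6 * X 1) (C n * X 0) (6 * X 2) := by
  refine aux_bh _ _ _ _ _ _ _ _ _ _ _ _ _ _ _ _ _ (aux_cubic m 0) (aux_cubic m 1)
    (aux_cubic m 2) (aux_cubic n 0) (aux_cubic n 1) (aux_cubic n 2) ?_ ?_ ?_ ?_ ?_ ?_ ?_ ?_ ?_ <;>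
    simp [-mul_eq_mul_left_iff, pderiv_X, Derivation.leibniz_pow, aux_num2, aux_num3,
      aux_num6, aux_num10, aux_num30] <;> ring

theorem aux_F6 (s : ℂ) (h : s * s = 3) :
    borderedHessian (C (-3 * (1 + s)) * (X 0 * X 1 * X 2) + (X 0 ^ 3 + X 1 ^ 3 + X 2 ^ 3))
      (C (-3 * (1 - s)) * (X 0 * X 1 * X 2) + (X 0 ^ 3 + X 1 ^ 3 + X 2 ^ 3)) +
    borderedHessian (C (-3 * (1 - s)) * (X 0 * X 1 * X 2) + (X 0 ^ 3 + X 1 ^ 3 + X 2 ^ 3))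
      (C (-3 * (1 + s)) * (X 0 * X 1 * X 2) + (X 0 ^ 3 + X 1 ^ 3 + X 2 ^ 3)) =
    C 648 * (X 0 ^ 6 + X 1 ^ 6 + X 2 ^ 6
      - 10 * (X 0 ^ 3 * X 1 ^ 3 + X 0 ^ 3 * X 2 ^ 3 + X 1 ^ 3 * X 2 ^ 3)) := by
  rw [aux_bh_cubic, aux_bh_cubic]
  have h1 : (C s * C s : MvPolynomial (Fin 3) ℂ) = 3 := by rw [← C_mul, h]; rfl
  have c1 : (C (-3 * (1 + s)) : MvPolynomial (Fin 3) ℂ) = -3 * (1 + C s) := by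
    simp only [C_mul, C_add, C_neg, C_1]; rfl
  have c2 : (C (-3 * (1 - s)) : MvPolynomial (Fin 3) ℂ) = -3 * (1 - C s) := by
    simp only [C_mul, C_sub, C_neg, C_1]; rfl
  have c3 : (C 648 : MvPolynomial (Fin 3) ℂ) = 648 := rfl
  rw [c1, c2, c3]
  have h2 : (C s ^ 2 : MvPolynomial (Fin 3) ℂ) = 3 := by rw [pow_two, h1]
  have h3 : (C s ^ 3 : MvPolynomial (Fin 3) ℂ) = 3 * C s := by rw [pow_succ, h2]
  have h4 : (C s ^ 4 : MvPolynomial (Fin 3) ℂ) = 9 := by rw [pow_succ, h3, mul_assoc, h1]; norm_num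
  generalize (C s : MvPolynomial (Fin 3) ℂ) = t at *
  generalize (X 0 : MvPolynomial (Fin 3) ℂ) = x at *
  generalize (X 1 : MvPolynomial (Fin 3) ℂ) = y at *
  generalize (X 2 : MvPolynomial (Fin 3) ℂ) = z at *
  ring_nf
  simp only [h2, h3, h4]
  ring

theorem aux_dF6 (i : Fin 3) :
    pderiv i (X 0 ^ 6 + X 1 ^ 6 + X 2 ^ 6
      - 10 * (X 0 ^ 3 * X 1 ^ 3 + X 0 ^ 3 * X 2 ^ 3 + X 1 ^ 3 * X 2 ^ 3) :
        MvPolynomial (Fin 3) ℂ) =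
      ![6 * X 0 ^ 5 - 30 * X 0 ^ 2 * (X 1 ^ 3 + X 2 ^ 3),
        6 * X 1 ^ 5 - 30 * X 1 ^ 2 * (X 0 ^ 3 + X 2 ^ 3),
        6 * X 2 ^ 5 - 30 * X 2 ^ 2 * (X 0 ^ 3 + X 1 ^ 3)] i := by
  fin_cases i <;>
    simp [-mul_eq_mul_left_iff, pderiv_X, Derivation.leibniz_pow, aux_num2, aux_num3,
      aux_num6, aux_num10, aux_num30] <;> ring

theorem aux_H6 :
    hessianDet (X 0 ^ 6 + X 1 ^ 6 + X 2 ^ 6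
      - 10 * (X 0 ^ 3 * X 1 ^ 3 + X 0 ^ 3 * X 2 ^ 3 + X 1 ^ 3 * X 2 ^ 3)) =
    C (-108000) * (X 0 * X 1 * X 2 * (21 * X 0 ^ 3 * X 1 ^ 3 * X 2 ^ 3
      - X 0 ^ 9 - X 1 ^ 9 - X 2 ^ 9 - 3 * (X 0 ^ 6 * X 1 ^ 3 + X 0 ^ 6 * X 2 ^ 3
      + X 1 ^ 6 * X 0 ^ 3 + X 1 ^ 6 * X 2 ^ 3 + X 2 ^ 6 * X 0 ^ 3 + X 2 ^ 6 * X 1 ^ 3))) := by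
  rw [aux_hd _ _ _ _
    (30 * X 0 ^ 4 - 60 * X 0 * (X 1 ^ 3 + X 2 ^ 3)) (-90 * X 0 ^ 2 * X 1 ^ 2)
    (-90 * X 0 ^ 2 * X 2 ^ 2)
    (-90 * X 0 ^ 2 * X 1 ^ 2) (30 * X 1 ^ 4 - 60 * X 1 * (X 0 ^ 3 + X 2 ^ 3))
    (-90 * X 1 ^ 2 * X 2 ^ 2)
    (-90 * X 0 ^ 2 * X 2 ^ 2) (-90 * X 1 ^ 2 * X 2 ^ 2)
    (30 * X 2 ^ 4 - 60 * X 2 * (X 0 ^ 3 + X 1 ^ 3))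
    (aux_dF6 0) (aux_dF6 1) (aux_dF6 2)]
  · have c3 : (C (-108000) : MvPolynomial (Fin 3) ℂ) = -108000 := by rw [C_neg]; rfl
    rw [c3]
    ring
  all_goals
    simp [-mul_eq_mul_left_iff, pderiv_X, Derivation.leibniz_pow, aux_num2, aux_num3,
      aux_num6, aux_num10, aux_num30] <;> ring

theorem aux_dR9 (i : Fin 3) :
    pderiv i ((X 0 ^ 3 - X 1 ^ 3) * (X 0 ^ 3 - X 2 ^ 3) * (X 1 ^ 3 - X 2 ^ 3) :
        MvPolynomial (Fin 3) ℂ) =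
      ![3 * X 0 ^ 2 * ((2 * X 0 ^ 3 - X 1 ^ 3 - X 2 ^ 3) * (X 1 ^ 3 - X 2 ^ 3)),
        3 * X 1 ^ 2 * ((X 0 ^ 3 - X 2 ^ 3) * (X 0 ^ 3 + X 2 ^ 3 - 2 * X 1 ^ 3)),
        3 * X 2 ^ 2 * ((X 0 ^ 3 - X 1 ^ 3) * (2 * X 2 ^ 3 - X 0 ^ 3 - X 1 ^ 3))] i := by
  fin_cases i <;>
    simp [-mul_eq_mul_left_iff, pderiv_X, Derivation.leibniz_pow, aux_num2, aux_num3,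
      aux_num6, aux_num10, aux_num30] <;> ring

set_option maxHeartbeats 4000000 in
theorem aux_B :
    borderedHessian (X 0 ^ 6 + X 1 ^ 6 + X 2 ^ 6
      - 10 * (X 0 ^ 3 * X 1 ^ 3 + X 0 ^ 3 * X 2 ^ 3 + X 1 ^ 3 * X 2 ^ 3))
      ((X 0 ^ 3 - X 1 ^ 3) * (X 0 ^ 3 - X 2 ^ 3) * (X 1 ^ 3 - X 2 ^ 3)) =
    C (-1296) * ((X 0 * X 1 * X 2 * (21 * X 0 ^ 3 * X 1 ^ 3 * X 2 ^ 3
      - X 0 ^ 9 - X 1 ^ 9 - X 2 ^ 9 - 3 * (X 0 ^ 6 * X 1 ^ 3 + X 0 ^ 6 * X 2 ^ 3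
      + X 1 ^ 6 * X 0 ^ 3 + X 1 ^ 6 * X 2 ^ 3 + X 2 ^ 6 * X 0 ^ 3 + X 2 ^ 6 * X 1 ^ 3))) *
      (X 0 ^ 12 + X 1 ^ 12 + X 2 ^ 12
      + C 12 * (X 0 ^ 9 * X 1 ^ 3 + X 0 ^ 9 * X 2 ^ 3 + X 1 ^ 9 * X 0 ^ 3 + X 1 ^ 9 * X 2 ^ 3
        + X 2 ^ 9 * X 0 ^ 3 + X 2 ^ 9 * X 1 ^ 3)
      + C (-26) * (X 0 ^ 6 * X 1 ^ 6 + X 0 ^ 6 * X 2 ^ 6 + X 1 ^ 6 * X 2 ^ 6)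
      + C 244 * (X 0 ^ 6 * X 1 ^ 3 * X 2 ^ 3 + X 0 ^ 3 * X 1 ^ 6 * X 2 ^ 3
        + X 0 ^ 3 * X 1 ^ 3 * X 2 ^ 6))) := by
  rw [aux_bh _ _
    (6 * X 0 ^ 5 - 30 * X 0 ^ 2 * (X 1 ^ 3 + X 2 ^ 3))
    (6 * X 1 ^ 5 - 30 * X 1 ^ 2 * (X 0 ^ 3 + X 2 ^ 3))
    (6 * X 2 ^ 5 - 30 * X 2 ^ 2 * (X 0 ^ 3 + X 1 ^ 3))
    (3 * X 0 ^ 2 * ((2 * X 0 ^ 3 - X 1 ^ 3 - X 2 ^ 3) * (X 1 ^ 3 - X 2 ^ 3)))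
    (3 * X 1 ^ 2 * ((X 0 ^ 3 - X 2 ^ 3) * (X 0 ^ 3 + X 2 ^ 3 - 2 * X 1 ^ 3)))
    (3 * X 2 ^ 2 * ((X 0 ^ 3 - X 1 ^ 3) * (2 * X 2 ^ 3 - X 0 ^ 3 - X 1 ^ 3)))
    (6 * X 0 * (5 * X 0 ^ 3 - X 1 ^ 3 - X 2 ^ 3) * (X 1 ^ 3 - X 2 ^ 3))
    (18 * X 0 ^ 2 * X 1 ^ 2 * (X 0 ^ 3 - X 1 ^ 3))
    (-18 * X 0 ^ 2 * X 2 ^ 2 * (X 0 ^ 3 - X 2 ^ 3))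
    (18 * X 0 ^ 2 * X 1 ^ 2 * (X 0 ^ 3 - X 1 ^ 3))
    (6 * X 1 * (X 0 ^ 3 + X 2 ^ 3 - 5 * X 1 ^ 3) * (X 0 ^ 3 - X 2 ^ 3))
    (18 * X 1 ^ 2 * X 2 ^ 2 * (X 1 ^ 3 - X 2 ^ 3))
    (-18 * X 0 ^ 2 * X 2 ^ 2 * (X 0 ^ 3 - X 2 ^ 3))
    (18 * X 1 ^ 2 * X 2 ^ 2 * (X 1 ^ 3 - X 2 ^ 3))
    (6 * X 2 * (5 * X 2 ^ 3 - X 0 ^ 3 - X 1 ^ 3) * (X 0 ^ 3 - X 1 ^ 3))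
    (aux_dF6 0) (aux_dF6 1) (aux_dF6 2) (aux_dR9 0) (aux_dR9 1) (aux_dR9 2)]
  · have c1 : (C (-1296) : MvPolynomial (Fin 3) ℂ) = -1296 := by rw [C_neg]; rfl
    have c2 : (C 12 : MvPolynomial (Fin 3) ℂ) = 12 := rfl
    have c3 : (C (-26) : MvPolynomial (Fin 3) ℂ) = -26 := by rw [C_neg]; rfl
    have c4 : (C 244 : MvPolynomial (Fin 3) ℂ) = 244 := rfl
    rw [c1, c2, c3, c4]
    clear c1 c2 c3 c4
    generalize (X 0 : MvPolynomial (Fin 3) ℂ) = x at *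
    generalize (X 1 : MvPolynomial (Fin 3) ℂ) = y at *
    generalize (X 2 : MvPolynomial (Fin 3) ℂ) = z at *
    ring
  all_goals
    simp [-mul_eq_mul_left_iff, pderiv_X, Derivation.leibniz_pow, aux_num2, aux_num3,
      aux_num6, aux_num10, aux_num30] <;> ring

theorem aux_hom1 (i : Fin 3) (n : ℕ) :
    (X i ^ n : MvPolynomial (Fin 3) ℂ).IsHomogeneous n := by
  simpa using (isHomogeneous_X ℂ i).pow n

theorem aux_hom2 (i j : Fin 3) (n m k : ℕ) (h : n + m = k) :
    (X i ^ n * X j ^ m : MvPolynomial (Fin 3) ℂ).IsHomogeneous k :=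
  h ▸ (aux_hom1 i n).mul (aux_hom1 j m)

theorem aux_hom3 (i j l : Fin 3) (n m p k : ℕ) (h : n + m + p = k) :
    (X i ^ n * X j ^ m * X l ^ p : MvPolynomial (Fin 3) ℂ).IsHomogeneous k :=
  h ▸ (aux_hom2 i j n m _ rfl).mul (aux_hom1 l p)

theorem aux_hom :
    (X 0 ^ 12 + X 1 ^ 12 + X 2 ^ 12
      + C 12 * (X 0 ^ 9 * X 1 ^ 3 + X 0 ^ 9 * X 2 ^ 3 + X 1 ^ 9 * X 0 ^ 3 + X 1 ^ 9 * X 2 ^ 3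
        + X 2 ^ 9 * X 0 ^ 3 + X 2 ^ 9 * X 1 ^ 3)
      + C (-26) * (X 0 ^ 6 * X 1 ^ 6 + X 0 ^ 6 * X 2 ^ 6 + X 1 ^ 6 * X 2 ^ 6)
      + C 244 * (X 0 ^ 6 * X 1 ^ 3 * X 2 ^ 3 + X 0 ^ 3 * X 1 ^ 6 * X 2 ^ 3
        + X 0 ^ 3 * X 1 ^ 3 * X 2 ^ 6) : MvPolynomial (Fin 3) ℂ).IsHomogeneous 12 := by
  have a1 := (((aux_hom1 0 12).add
    (aux_hom1 1 12)).add
    (aux_hom1 2 12))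
  refine ((a1.add (IsHomogeneous.C_mul ?_ _)).add (IsHomogeneous.C_mul ?_ _)).add
    (IsHomogeneous.C_mul ?_ _)
  · exact ((((((aux_hom2 0 1 9 3 12 rfl).add
    (aux_hom2 0 2 9 3 12 rfl)).add
    (aux_hom2 1 0 9 3 12 rfl)).add
    (aux_hom2 1 2 9 3 12 rfl)).add
    (aux_hom2 2 0 9 3 12 rfl)).add
    (aux_hom2 2 1 9 3 12 rfl))
  · exact (((aux_hom2 0 1 6 6 12 rfl).add
    (aux_hom2 0 2 6 6 12 rfl)).add
    (aux_hom2 1 2 6 6 12 rfl))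
  · exact (((aux_hom3 0 1 2 6 3 3 12 rfl).add
    (aux_hom3 0 1 2 3 6 3 12 rfl)).add
    (aux_hom3 0 1 2 3 3 6 12 rfl))

theorem Phi12_divides_borderedHessian_F6_R9 (s : ℂ) (hs : s = ((Real.sqrt 3 : ℝ) : ℂ))
    (P₃ S₃ F₃ Φ₃ F₆ Φ₁₂ R₉ : MvPolynomial (Fin 3) ℂ)
    (hP₃ : P₃ = X 0 * X 1 * X 2)
    (hS₃ : S₃ = X 0 ^ 3 + X 1 ^ 3 + X 2 ^ 3)
    (hF₃ : F₃ = MvPolynomial.C (-3 * (1 + s)) * P₃ + S₃)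
    (hΦ₃ : Φ₃ = MvPolynomial.C (-3 * (1 - s)) * P₃ + S₃)
    (hF₆ : F₆ = MvPolynomial.C (1 / 648 : ℂ) *
        (borderedHessian F₃ Φ₃ + borderedHessian Φ₃ F₃))
    (hΦ₁₂ : Φ₁₂ = MvPolynomial.C (-1 / 108000 : ℂ) * hessianDet F₆)
    (hR₉ : R₉ = (X 0 ^ 3 - X 1 ^ 3) * (X 0 ^ 3 - X 2 ^ 3) * (X 1 ^ 3 - X 2 ^ 3)) :
    ∃ F₁₂ : MvPolynomial (Fin 3) ℂ, F₁₂.IsHomogeneous 12 ∧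
      borderedHessian F₆ R₉ = MvPolynomial.C (675 : ℂ) * Φ₁₂ * F₁₂ := by
  have h : s * s = 3 := by
    rw [hs, ← Complex.ofReal_mul, Real.mul_self_sqrt (by norm_num)]; norm_num
  subst hP₃ hS₃
  rw [hF₃, hΦ₃, aux_F6 s h, ← mul_assoc, ← C_mul, show (1 / 648 * 648 : ℂ) = 1 by norm_num,
    C_1, one_mul] at hF₆
  rw [hF₆, aux_H6, ← mul_assoc, ← C_mul, show (-1 / 108000 * -108000 : ℂ) = 1 by norm_num,
    C_1, one_mul] at hΦ₁₂
  refine ⟨C (-48 / 25) * _, aux_hom.C_mul _, ?_⟩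
  rw [hF₆, hR₉, hΦ₁₂, aux_B, show (-1296 : ℂ) = 675 * (-48 / 25) by norm_num, C_mul]
  generalize (C (-48 / 25) : MvPolynomial (Fin 3) ℂ) = c
  generalize (C 675 : MvPolynomial (Fin 3) ℂ) = d
  rw [mul_assoc d, mul_assoc d, mul_left_comm c]
end

section
/- In ℂ[X₁,X₂,X₃], let P₃ = X₁X₂X₃, S₃ = X₁³ + X₂³ + X₃³, F₃ = −3(1+√3)·P₃ + S₃, Φ₃ = −3(1−√3)·P₃ + S₃, F₆ = (HB(F₃,Φ₃) + HB(Φ₃,F₃))/648, Φ₁₂ = −H(F₆)/108000, and R₉ = (X₁³−X₂³)(X₁³−X₃³)(X₂³−X₃³). Then there exists a constant c ∈ ℂ such that H(R₉) = c·R₉·Φ₁₂. -/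
open MvPolynomial

set_option linter.all false
set_option linter.unusedSimpArgs false
set_option linter.unreachableTactic false
set_option linter.unusedTactic false

lemma aux_num (i : Fin 3) (n : ℕ) [n.AtLeastTwo] :
    pderiv i (ofNat(n) : MvPolynomial (Fin 3) ℂ) = 0 :=
  (pderiv i).map_natCast n

lemma aux_hess (P : MvPolynomial (Fin 3) ℂ) (a b c d e f : MvPolynomial (Fin 3) ℂ)
    (h00 : pderiv 0 (pderiv 0 P) = a) (h11 : pderiv 1 (pderiv 1 P) = b)
    (h22 : pderiv 2 (pderiv 2 P) = c) (h01 : pderiv 0 (pderiv 1 P) = d)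
    (h02 : pderiv 0 (pderiv 2 P) = e) (h12 : pderiv 1 (pderiv 2 P) = f)
    (h10 : pderiv 1 (pderiv 0 P) = d) (h20 : pderiv 2 (pderiv 0 P) = e)
    (h21 : pderiv 2 (pderiv 1 P) = f) :
    hessianDet P = a * b * c + 2 * d * e * f - a * f ^ 2 - b * e ^ 2 - c * d ^ 2 := by
  unfold hessianDet
  rw [Matrix.det_fin_three]
  simp only [Matrix.of_apply, h00, h11, h22, h01, h02, h12, h10, h20, h21]
  ring

set_option maxHeartbeats 1000000 in
lemma aux_bord (P Q : MvPolynomial (Fin 3) ℂ) (a b c d e f u v w : MvPolynomial (Fin 3) ℂ)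
    (h00 : pderiv 0 (pderiv 0 P) = a) (h11 : pderiv 1 (pderiv 1 P) = b)
    (h22 : pderiv 2 (pderiv 2 P) = c) (h01 : pderiv 0 (pderiv 1 P) = d)
    (h02 : pderiv 0 (pderiv 2 P) = e) (h12 : pderiv 1 (pderiv 2 P) = f)
    (h10 : pderiv 1 (pderiv 0 P) = d) (h20 : pderiv 2 (pderiv 0 P) = e)
    (h21 : pderiv 2 (pderiv 1 P) = f)
    (hu : pderiv 0 Q = u) (hv : pderiv 1 Q = v) (hw : pderiv 2 Q = w) :
    borderedHessian Q P = -(u ^ 2 * (b * c - f ^ 2) + v ^ 2 * (a * c - e ^ 2)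
      + w ^ 2 * (a * b - d ^ 2) + 2 * u * v * (e * f - c * d)
      + 2 * u * w * (d * f - b * e) + 2 * v * w * (d * e - a * f)) := by
  have hM : (Matrix.of fun i j : Fin 4 =>
    if hi : (i : ℕ) < 3 then
      if hj : (j : ℕ) < 3 then pderiv (⟨i, hi⟩ : Fin 3) (pderiv (⟨j, hj⟩ : Fin 3) P)
      else pderiv (⟨i, hi⟩ : Fin 3) Q
    else
      if hj : (j : ℕ) < 3 then pderiv (⟨j, hj⟩ : Fin 3) Q
      else 0) = !![a, d, e, u; d, b, f, v; e, f, c, w; u, v, w, 0] := by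
    ext1 i j
    fin_cases i <;> fin_cases j
    · exact h00
    · exact h01
    · exact h02
    · exact hu
    · exact h10
    · exact h11
    · exact h12
    · exact hv
    · exact h20
    · exact h21
    · exact h22
    · exact hw
    · exact hu
    · exact hv
    · exact hw
    · rfl
  unfold borderedHessian
  rw [hM]
  simp [Matrix.det_succ_row_zero, Fin.sum_univ_succ, Fin.succAbove]
  ring

set_option maxHeartbeats 1000000 in
lemma aux_cub (t r : ℂ) : borderedHessian (C t * (X 0 * X 1 * X 2) + (X 0 ^ 3 + X 1 ^ 3 + X 2 ^ 3) : MvPolynomial (Fin 3) ℂ) (C r * (X 0 * X 1 * X 2) + (X 0 ^ 3 + X 1 ^ 3 + X 2 ^ 3) : MvPolynomial (Fin 3) ℂ) =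
    -((C t * (X 1 * X 2) + 3 * X 0 ^ 2) ^ 2 * ((6 * X 1) * (6 * X 2) - (C r * X 0) ^ 2) + (C t * (X 0 * X 2) + 3 * X 1 ^ 2) ^ 2 * ((6 * X 0) * (6 * X 2) - (C r * X 1) ^ 2)
      + (C t * (X 0 * X 1) + 3 * X 2 ^ 2) ^ 2 * ((6 * X 0) * (6 * X 1) - (C r * X 2) ^ 2) + 2 * (C t * (X 1 * X 2) + 3 * X 0 ^ 2) * (C t * (X 0 * X 2) + 3 * X 1 ^ 2) * ((C r * X 1) * (C r * X 0) - (6 * X 2) * (C r * X 2))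
      + 2 * (C t * (X 1 * X 2) + 3 * X 0 ^ 2) * (C t * (X 0 * X 1) + 3 * X 2 ^ 2) * ((C r * X 2) * (C r * X 0) - (6 * X 1) * (C r * X 1)) + 2 * (C t * (X 0 * X 2) + 3 * X 1 ^ 2) * (C t * (X 0 * X 1) + 3 * X 2 ^ 2) * ((C r * X 2) * (C r * X 1) - (6 * X 0) * (C r * X 0))) := by
  have e0 (R : ℂ) : pderiv 0 (C R * (X 0 * X 1 * X 2) + (X 0 ^ 3 + X 1 ^ 3 + X 2 ^ 3) : MvPolynomial (Fin 3) ℂ) = (C R * (X 1 * X 2) + 3 * X 0 ^ 2) := by (simp [Derivation.leibniz_pow, pderiv_X, aux_num]; try first | ring1 | (ring_nf; simp))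
  have e1 (R : ℂ) : pderiv 1 (C R * (X 0 * X 1 * X 2) + (X 0 ^ 3 + X 1 ^ 3 + X 2 ^ 3) : MvPolynomial (Fin 3) ℂ) = (C R * (X 0 * X 2) + 3 * X 1 ^ 2) := by (simp [Derivation.leibniz_pow, pderiv_X, aux_num]; try first | ring1 | (ring_nf; simp))
  have e2 (R : ℂ) : pderiv 2 (C R * (X 0 * X 1 * X 2) + (X 0 ^ 3 + X 1 ^ 3 + X 2 ^ 3) : MvPolynomial (Fin 3) ℂ) = (C R * (X 0 * X 1) + 3 * X 2 ^ 2) := by (simp [Derivation.leibniz_pow, pderiv_X, aux_num]; try first | ring1 | (ring_nf; simp))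
  apply aux_bord
  all_goals first | rw [e0] | rw [e1] | rw [e2]
  all_goals (simp [Derivation.leibniz_pow, pderiv_X, aux_num]; try first | ring1 | (ring_nf; simp))

local notation "pF" => ((1) * X 2 ^ 6 + (-10) * X 1 ^ 3 * X 2 ^ 3 + (1) * X 1 ^ 6 + (-10) * X 0 ^ 3 * X 2 ^ 3 + (-10) * X 0 ^ 3 * X 1 ^ 3 + (1) * X 0 ^ 6 : MvPolynomial (Fin 3) ℂ)
local notation "pR" => ((-1) * X 1 ^ 3 * X 2 ^ 6 + (1) * X 1 ^ 6 * X 2 ^ 3 + (1) * X 0 ^ 3 * X 2 ^ 6 + (-1) * X 0 ^ 3 * X 1 ^ 6 + (-1) * X 0 ^ 6 * X 2 ^ 3 + (1) * X 0 ^ 6 * X 1 ^ 3 : MvPolynomial (Fin 3) ℂ)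
local notation "pQ" => ((-1) * X 0 ^ 1 * X 1 ^ 1 * X 2 ^ 10 + (-3) * X 0 ^ 1 * X 1 ^ 4 * X 2 ^ 7 + (-3) * X 0 ^ 1 * X 1 ^ 7 * X 2 ^ 4 + (-1) * X 0 ^ 1 * X 1 ^ 10 * X 2 ^ 1 + (-3) * X 0 ^ 4 * X 1 ^ 1 * X 2 ^ 7 + (21) * X 0 ^ 4 * X 1 ^ 4 * X 2 ^ 4 + (-3) * X 0 ^ 4 * X 1 ^ 7 * X 2 ^ 1 + (-3) * X 0 ^ 7 * X 1 ^ 1 * X 2 ^ 4 + (-3) * X 0 ^ 7 * X 1 ^ 4 * X 2 ^ 1 + (-1) * X 0 ^ 10 * X 1 ^ 1 * X 2 ^ 1 : MvPolynomial (Fin 3) ℂ)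

set_option maxHeartbeats 4000000 in
lemma aux_F6_s15 : hessianDet pF = (-108000) * pQ := by
  have e0 : pderiv 0 pF = ((-30) * X 0 ^ 2 * X 2 ^ 3 + (-30) * X 0 ^ 2 * X 1 ^ 3 + (6) * X 0 ^ 5) := by
    (simp [Derivation.leibniz_pow, pderiv_X, aux_num]; try first | ring1 | (ring_nf; simp))
  have e1 : pderiv 1 pF = ((-30) * X 1 ^ 2 * X 2 ^ 3 + (6) * X 1 ^ 5 + (-30) * X 0 ^ 3 * X 1 ^ 2) := by
    (simp [Derivation.leibniz_pow, pderiv_X, aux_num]; try first | ring1 | (ring_nf; simp))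
  have e2 : pderiv 2 pF = ((6) * X 2 ^ 5 + (-30) * X 1 ^ 3 * X 2 ^ 2 + (-30) * X 0 ^ 3 * X 2 ^ 2) := by
    (simp [Derivation.leibniz_pow, pderiv_X, aux_num]; try first | ring1 | (ring_nf; simp))
  rw [aux_hess pF
    ((-60) * X 0 ^ 1 * X 2 ^ 3 + (-60) * X 0 ^ 1 * X 1 ^ 3 + (30) * X 0 ^ 4) 
    ((-60) * X 1 ^ 1 * X 2 ^ 3 + (30) * X 1 ^ 4 + (-60) * X 0 ^ 3 * X 1 ^ 1) 
    ((30) * X 2 ^ 4 + (-60) * X 1 ^ 3 * X 2 ^ 1 + (-60) * X 0 ^ 3 * X 2 ^ 1) 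
    ((-90) * X 0 ^ 2 * X 1 ^ 2) 
    ((-90) * X 0 ^ 2 * X 2 ^ 2) 
    ((-90) * X 1 ^ 2 * X 2 ^ 2)]
  · ring
  all_goals first | rw [e0] | rw [e1] | rw [e2]
  all_goals (simp [Derivation.leibniz_pow, pderiv_X, aux_num]; try first | ring1 | (ring_nf; simp))

set_option maxHeartbeats 4000000 in
lemma aux_R9 : hessianDet pR = (-864) * (pR * pQ) := by
  have e0 : pderiv 0 pR = ((3) * X 0 ^ 2 * X 2 ^ 6 + (-3) * X 0 ^ 2 * X 1 ^ 6 + (-6) * X 0 ^ 5 * X 2 ^ 3 + (6) * X 0 ^ 5 * X 1 ^ 3) := by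
    (simp [Derivation.leibniz_pow, pderiv_X, aux_num]; try first | ring1 | (ring_nf; simp))
  have e1 : pderiv 1 pR = ((-3) * X 1 ^ 2 * X 2 ^ 6 + (6) * X 1 ^ 5 * X 2 ^ 3 + (-6) * X 0 ^ 3 * X 1 ^ 5 + (3) * X 0 ^ 6 * X 1 ^ 2) := by
    (simp [Derivation.leibniz_pow, pderiv_X, aux_num]; try first | ring1 | (ring_nf; simp))
  have e2 : pderiv 2 pR = ((-6) * X 1 ^ 3 * X 2 ^ 5 + (3) * X 1 ^ 6 * X 2 ^ 2 + (6) * X 0 ^ 3 * X 2 ^ 5 + (-3) * X 0 ^ 6 * X 2 ^ 2) := by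
    (simp [Derivation.leibniz_pow, pderiv_X, aux_num]; try first | ring1 | (ring_nf; simp))
  rw [aux_hess pR
    ((6) * X 0 ^ 1 * X 2 ^ 6 + (-6) * X 0 ^ 1 * X 1 ^ 6 + (-30) * X 0 ^ 4 * X 2 ^ 3 + (30) * X 0 ^ 4 * X 1 ^ 3) 
    ((-6) * X 1 ^ 1 * X 2 ^ 6 + (30) * X 1 ^ 4 * X 2 ^ 3 + (-30) * X 0 ^ 3 * X 1 ^ 4 + (6) * X 0 ^ 6 * X 1 ^ 1) 
    ((-30) * X 1 ^ 3 * X 2 ^ 4 + (6) * X 1 ^ 6 * X 2 ^ 1 + (30) * X 0 ^ 3 * X 2 ^ 4 + (-6) * X 0 ^ 6 * X 2 ^ 1) 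
    ((-18) * X 0 ^ 2 * X 1 ^ 5 + (18) * X 0 ^ 5 * X 1 ^ 2) 
    ((18) * X 0 ^ 2 * X 2 ^ 5 + (-18) * X 0 ^ 5 * X 2 ^ 2) 
    ((-18) * X 1 ^ 2 * X 2 ^ 5 + (18) * X 1 ^ 5 * X 2 ^ 2)]
  · ring
  all_goals first | rw [e0] | rw [e1] | rw [e2]
  all_goals (simp [Derivation.leibniz_pow, pderiv_X, aux_num]; try first | ring1 | (ring_nf; simp))

theorem hessian_R9_eq_const_mul_R9_Phi12 (s : ℂ) (hs : s = ((Real.sqrt 3 : ℝ) : ℂ))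
    (P₃ S₃ F₃ Φ₃ F₆ Φ₁₂ R₉ : MvPolynomial (Fin 3) ℂ)
    (hP₃ : P₃ = X 0 * X 1 * X 2)
    (hS₃ : S₃ = X 0 ^ 3 + X 1 ^ 3 + X 2 ^ 3)
    (hF₃ : F₃ = MvPolynomial.C (-3 * (1 + s)) * P₃ + S₃)
    (hΦ₃ : Φ₃ = MvPolynomial.C (-3 * (1 - s)) * P₃ + S₃)
    (hF₆ : F₆ = MvPolynomial.C (1 / 648 : ℂ) *
        (borderedHessian F₃ Φ₃ + borderedHessian Φ₃ F₃))
    (hΦ₁₂ : Φ₁₂ = MvPolynomial.C (-1 / 108000 : ℂ) * hessianDet F₆)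
    (hR₉ : R₉ = (X 0 ^ 3 - X 1 ^ 3) * (X 0 ^ 3 - X 2 ^ 3) * (X 1 ^ 3 - X 2 ^ 3)) :
    ∃ c : ℂ, hessianDet R₉ = MvPolynomial.C c * (R₉ * Φ₁₂) := by
  have hs2 : (C s : MvPolynomial (Fin 3) ℂ) ^ 2 = 3 := by
    rw [← map_pow, hs, ← Complex.ofReal_pow, Real.sq_sqrt (by norm_num)]
    exact map_ofNat C 3
  have hs3 : (C s : MvPolynomial (Fin 3) ℂ) ^ 3 = 3 * C s := by rw [pow_succ, hs2]
  have hs4 : (C s : MvPolynomial (Fin 3) ℂ) ^ 4 = 9 := by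
    rw [show (C s : MvPolynomial (Fin 3) ℂ) ^ 4 = (C s ^ 2) ^ 2 by ring, hs2]; norm_num
  have c1 : (C (-3 * (1 + s)) : MvPolynomial (Fin 3) ℂ) = -3 * (1 + C s) := by
    rw [map_mul, map_add, map_neg, map_ofNat, map_one]
  have c2 : (C (-3 * (1 - s)) : MvPolynomial (Fin 3) ℂ) = -3 * (1 - C s) := by
    rw [map_mul, map_sub, map_neg, map_ofNat, map_one]
  have k1 : (C (1 / 648 : ℂ) : MvPolynomial (Fin 3) ℂ) * 648 = 1 := by
    rw [← map_ofNat C 648, ← map_mul]; norm_num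
  have k2 : (C (-1 / 108000 : ℂ) : MvPolynomial (Fin 3) ℂ) * (-108000) = 1 := by
    rw [← map_ofNat C 108000, ← map_neg, ← map_mul]; norm_num
  have hB : borderedHessian F₃ Φ₃ + borderedHessian Φ₃ F₃ = 648 * pF := by
    rw [hF₃, hΦ₃, hP₃, hS₃, aux_cub, aux_cub, c1, c2]
    ring_nf
    simp only [hs2, hs3, hs4]
    ring
  have h6 : F₆ = pF := by
    rw [hF₆, hB, ← mul_assoc, k1, one_mul]
  have h12 : Φ₁₂ = pQ := by
    rw [hΦ₁₂, h6, aux_F6_s15]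
    linear_combination pQ * k2
  have h9 : R₉ = pR := by
    rw [hR₉]; ring
  refine ⟨-864, ?_⟩
  rw [h9, h12, aux_R9, map_neg, map_ofNat]
end
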